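/- Let p > q be primes with q dividing p − 1, let n = pq, let Γ be a cyclic group of order n, and let M = C_p ⋊ C_q be the nonabelian group of order pq (where C_q acts nontrivially on C_p). Then the number of regular subgroups of Perm(Γ) that are isomorphic to M and normalized by the left-translation subgroup λ(Γ) is 2(q − 1), and the number of regular subgroups of Perm(Γ) that are isomorphic to Γ and normalized by λ(Γ) is 1. (Equivalently, a cyclic Galois field extension of degree pq admits exactly 2(q−1) Hopf–Galois structures of type M and exactly one of cyclic type.) -/

import Mathlib

/-- A subgroup `N ≤ Perm Γ` is regular: its action on `Γ` is transitive and
the stabiliser of every point is trivial. -/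
def IsRegularSubgroup (Γ : Type*) [Group Γ] (N : Subgroup (Equiv.Perm Γ)) : Prop :=
  (∀ x y : Γ, ∃ ν ∈ N, ν x = y) ∧ ∀ ν ∈ N, ∀ x : Γ, ν x = x → ν = 1

/-- A subgroup `N ≤ Perm Γ` is normalised by the subgroup `λ(Γ)` of left translations. -/
def IsNormalizedByLeftTranslations (Γ : Type*) [Group Γ] (N : Subgroup (Equiv.Perm Γ)) : Prop :=
  ∀ γ : Γ, ∀ ν ∈ N, Equiv.mulLeft γ * ν * (Equiv.mulLeft γ)⁻¹ ∈ N

section Generic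

lemma pv_cast {G : Type*} [Monoid G] {n : ℕ} {g : G} (h : g ^ n = 1) (k : ℕ) :
    g ^ ((k : ZMod n)).val = g ^ k := by
  rw [ZMod.val_natCast]; exact (pow_eq_pow_mod k h).symm

lemma pv_add {G : Type*} [Monoid G] {n : ℕ} [NeZero n] {g : G} (h : g ^ n = 1) (a b : ZMod n) :
    g ^ (a + b).val = g ^ a.val * g ^ b.val := by
  rw [ZMod.val_add, ← pow_eq_pow_mod _ h, pow_add]

lemma pv_mul {G : Type*} [Monoid G] {n : ℕ} {g : G} (h : g ^ n = 1) (a b : ZMod n) :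
    g ^ (a * b).val = (g ^ a.val) ^ b.val := by
  rw [ZMod.val_mul, ← pow_eq_pow_mod _ h, pow_mul]

lemma pv_one {G : Type*} [Monoid G] {n : ℕ} {g : G} (h : g ^ n = 1) :
    g ^ (1 : ZMod n).val = g := by
  have := pv_cast h 1
  simpa using this

lemma conj_pow_nat {G : Type*} [Group G] {b t : G} {j : ℕ} (h : b * t * b⁻¹ = t ^ j) (i : ℕ) :
    b ^ i * t * (b ^ i)⁻¹ = t ^ (j ^ i) := by
  induction i with
  | zero => simp
  | succ i ih =>
    have : b ^ (i + 1) * t * (b ^ (i + 1))⁻¹ = b * (b ^ i * t * (b ^ i)⁻¹) * b⁻¹ := by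
      rw [pow_succ']; group
    rw [this, ih, ← conj_pow, h, ← pow_mul, pow_succ']

lemma commute_of_conj {G : Type*} [Group G] {r : ℕ} [Fact r.Prime] {b t : G} {j : ℕ}
    (ht : t ^ r = 1) (hb : b ^ r = 1) (h : b * t * b⁻¹ = t ^ j) : b * t * b⁻¹ = t := by
  have h1 := conj_pow_nat h r
  rw [hb, ← pv_cast ht] at h1
  rw [Nat.cast_pow, ZMod.pow_card, pv_cast ht] at h1
  rw [h, ← h1]; simp

variable {p q : ℕ} [hp : Fact p.Prime] [hq : Fact q.Prime]

/-- Structure of groups of order `pq`. -/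
lemma pq_struct {G : Type*} [Group G] (hlt : q < p) (hG : Nat.card G = p * q) :
    ∃ s t : G, orderOf s = p ∧ orderOf t = q ∧ (∀ g : G, g ^ p = 1 → ∃ k : ℕ, g = s ^ k) ∧
      ∀ g : G, ∃ i j : ℕ, g = s ^ i * t ^ j := by
  have hfin : Finite G := Nat.finite_of_card_ne_zero (by
    rw [hG]; exact mul_ne_zero hp.out.ne_zero hq.out.ne_zero)
  obtain ⟨s, hs⟩ := exists_prime_orderOf_dvd_card' (G := G) p (hG ▸ dvd_mul_right _ _)
  obtain ⟨t, ht⟩ := exists_prime_orderOf_dvd_card' (G := G) q (hG ▸ dvd_mul_left _ _)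
  have hidx : (Subgroup.zpowers s).index = q := by
    have := Subgroup.card_mul_index (Subgroup.zpowers s)
    rw [Nat.card_zpowers, hs, hG] at this
    exact Nat.eq_of_mul_eq_mul_left hp.out.pos this
  have hnorm : (Subgroup.zpowers s).Normal := by
    apply Subgroup.normal_of_index_eq_minFac_card
    rw [hidx, hG]
    symm
    apply le_antisymm
    · exact Nat.minFac_le_of_dvd hq.out.two_le (dvd_mul_left _ _)
    · have h1 : (p * q).minFac.Prime := Nat.minFac_prime (by
        intro h; exact hp.out.one_lt.ne' (Nat.eq_one_of_mul_eq_one_right h))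
      rcases (Nat.Prime.dvd_mul h1).1 (Nat.minFac_dvd (p * q)) with h | h
      · rw [(Nat.prime_dvd_prime_iff_eq h1 hp.out).1 h]; exact hlt.le
      · rw [(Nat.prime_dvd_prime_iff_eq h1 hq.out).1 h]
  have hcop : p.Coprime q := (Nat.coprime_primes hp.out hq.out).2 hlt.ne'
  refine ⟨s, t, hs, ht, ?_, ?_⟩
  · intro g hg
    have h1 : (QuotientGroup.mk g : G ⧸ Subgroup.zpowers s) = 1 := by
      rw [← orderOf_eq_one_iff]
      apply Nat.eq_one_of_dvd_coprimes hcop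
      · apply orderOf_dvd_of_pow_eq_one
        rw [← QuotientGroup.mk_pow, hg]; rfl
      · rw [← hidx]
        exact orderOf_dvd_natCard _
    rw [QuotientGroup.eq_one_iff, ← mem_powers_iff_mem_zpowers] at h1
    obtain ⟨k, hk⟩ := h1
    exact ⟨k, hk.symm⟩
  · have hinj : Function.Injective
        (fun x : Subgroup.zpowers s × Subgroup.zpowers t => (x.1 : G) * x.2) := by
      rintro ⟨⟨a, ha⟩, ⟨b, hb⟩⟩ ⟨⟨c, hc⟩, ⟨d, hd⟩⟩ h
      simp only at h
      have h2 : c⁻¹ * a = d * b⁻¹ := by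
        rw [inv_mul_eq_iff_eq_mul, ← mul_assoc, ← h]; group
      have h3 : c⁻¹ * a ∈ Subgroup.zpowers s := mul_mem (inv_mem hc) ha
      have h4 : c⁻¹ * a ∈ Subgroup.zpowers t := h2 ▸ mul_mem hd (inv_mem hb)
      have h5 : c⁻¹ * a = 1 := by
        rw [← orderOf_eq_one_iff]
        apply Nat.eq_one_of_dvd_coprimes hcop
        · rw [← hs]; exact orderOf_dvd_of_mem_zpowers h3
        · rw [← ht]; exact orderOf_dvd_of_mem_zpowers h4
      have h6 : d * b⁻¹ = 1 := h2 ▸ h5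
      have h7 : c = a := inv_mul_eq_one.1 h5
      have h8 : d = b := mul_inv_eq_one.1 h6
      subst h7 h8; rfl
    have hbij := hinj.bijective_of_nat_card_le (by
      rw [Nat.card_prod, Nat.card_zpowers, Nat.card_zpowers, hs, ht, hG])
    intro g
    obtain ⟨⟨⟨a, ha⟩, ⟨b, hb⟩⟩, h⟩ := hbij.2 g
    rw [← mem_powers_iff_mem_zpowers] at ha hb
    obtain ⟨i, rfl⟩ := ha
    obtain ⟨j, rfl⟩ := hb
    exact ⟨i, j, h.symm⟩

lemma pq_cyclic {G : Type*} [Group G] (hlt : q < p) (hG : Nat.card G = p * q)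
    (hc : ∀ x y : G, x * y = y * x) : IsCyclic G := by
  obtain ⟨s, t, hs, ht, -, -⟩ := pq_struct hlt hG
  have hcop : p.Coprime q := (Nat.coprime_primes hp.out hq.out).2 hlt.ne'
  have hfin : Finite G := Nat.finite_of_card_ne_zero (by
    rw [hG]; exact mul_ne_zero hp.out.ne_zero hq.out.ne_zero)
  apply isCyclic_of_orderOf_eq_card (s * t)
  have : Commute s t := hc s t
  rw [this.orderOf_mul_eq_mul_orderOf_of_coprime (by rwa [hs, ht]), hs, ht, hG]

/-- Generators of a nonabelian group of order `pq`, with prescribed action. -/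
lemma pq_gens {G : Type*} [Group G] (hlt : q < p) (hG : Nat.card G = p * q)
    (hc : ∃ x y : G, x * y ≠ y * x) {v : ZMod p} (hv : v ^ q = 1) (hv1 : v ≠ 1) :
    ∃ s t : G, orderOf s = p ∧ orderOf t = q ∧ t * s * t⁻¹ = s ^ v.val := by
  obtain ⟨s, t, hs, ht, h1, h2⟩ := pq_struct hlt hG
  have hsp : s ^ p = 1 := hs ▸ pow_orderOf_eq_one s
  have htq : t ^ q = 1 := ht ▸ pow_orderOf_eq_one t
  obtain ⟨m, hm⟩ := h1 (t * s * t⁻¹) (by rw [conj_pow, hsp]; simp)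
  have hmq : (m : ZMod p) ^ q = 1 := by
    have := conj_pow_nat hm q
    rw [htq] at this
    simp only [one_mul, inv_one, mul_one] at this
    have h3 : s ^ 1 = s ^ (m ^ q) := by simpa using this
    rw [pow_eq_pow_iff_modEq, hs, ← ZMod.natCast_eq_natCast_iff] at h3
    simpa using h3.symm
  have hm1 : (m : ZMod p) ≠ 1 := by
    intro h
    have hst : Commute t s := by
      have : s ^ m = s := by
        rw [← pv_cast hsp, h, pv_one hsp]
      rw [this, mul_inv_eq_iff_eq_mul] at hm
      exact hm
    obtain ⟨x, y, hxy⟩ := hc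
    apply hxy
    obtain ⟨i, j, rfl⟩ := h2 x
    obtain ⟨k, l, rfl⟩ := h2 y
    have hss : Commute s s := Commute.refl s
    have htt : Commute t t := Commute.refl t
    exact (((hss.pow_pow i k).mul_left (hst.pow_pow j k)).mul_right
      ((hst.symm.pow_pow i l).mul_left (htt.pow_pow j l))).eq
  have hprim : IsPrimitiveRoot (m : ZMod p) q := by
    rw [← orderOf_eq_prime hmq hm1]; exact IsPrimitiveRoot.orderOf _
  obtain ⟨i, -, hi⟩ := hprim.eq_pow_of_pow_eq_one hv
  have hconj : t ^ i * s * (t ^ i)⁻¹ = s ^ v.val := by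
    rw [conj_pow_nat hm, ← pv_cast hsp, Nat.cast_pow, hi]
  refine ⟨s, t ^ i, hs, ?_, hconj⟩
  apply orderOf_eq_prime
  · rw [← pow_mul, mul_comm, pow_mul, htq, one_pow]
  · intro h
    rw [h] at hconj
    apply hv1
    have h3 : s ^ 1 = s ^ v.val := by simpa using hconj
    rw [pow_eq_pow_iff_modEq, hs, ← ZMod.natCast_eq_natCast_iff] at h3
    simpa using h3.symm

end Generic

section Family

variable {p q : ℕ} [hp : Fact p.Prime] [hq : Fact q.Prime]

/-- Regular subgroups normalised by translations, in additive coordinates. -/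
structure RN (N : Subgroup (Equiv.Perm (ZMod p × ZMod q))) : Prop where
  trans : ∀ x y, ∃ ν ∈ N, ν x = y
  free : ∀ ν ∈ N, ∀ x, ν x = x → ν = 1
  norm : ∀ w, ∀ ν ∈ N, ∃ ν' ∈ N, ∀ z, ν' (w + z) = w + ν z

lemma ch_ne {u : ZMod p} (hu : u ^ q = 1) (y : ℕ) : u ^ y ≠ 0 := by
  apply pow_ne_zero
  rintro rfl
  rw [zero_pow hq.out.ne_zero] at hu
  exact zero_ne_one hu

/-- The permutation `(x, y) ↦ (v ^ t x + s u ^ y, y + t)`. -/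
def ff (u v : {u : ZMod p // u ^ q = 1}) (s : ZMod p) (t : ZMod q) :
    Equiv.Perm (ZMod p × ZMod q) where
  toFun z := (v.1 ^ t.val * z.1 + s * u.1 ^ z.2.val, z.2 + t)
  invFun z := (v.1 ^ (-t).val * (z.1 - s * u.1 ^ (z.2 - t).val), z.2 - t)
  left_inv := by
    rintro ⟨x, y⟩
    have h : v.1 ^ (-t).val * v.1 ^ t.val = 1 := by
      rw [← pv_add v.2]; simp
    simp only [add_sub_cancel_right, ← mul_assoc, h, one_mul]
  right_inv := by
    rintro ⟨x, y⟩
    have h : v.1 ^ t.val * v.1 ^ (-t).val = 1 := by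
      rw [← pv_add v.2]; simp
    simp only [sub_add_cancel, ← mul_assoc, h, one_mul]

lemma ff_apply (u v : {u : ZMod p // u ^ q = 1}) (s : ZMod p) (t : ZMod q) (x : ZMod p)
    (y : ZMod q) : ff u v s t (x, y) = (v.1 ^ t.val * x + s * u.1 ^ y.val, y + t) := rfl

lemma ff_mul (u v : {u : ZMod p // u ^ q = 1}) (s s' : ZMod p) (t t' : ZMod q) :
    ff u v s' t' * ff u v s t = ff u v (v.1 ^ t'.val * s + u.1 ^ t.val * s') (t + t') := by
  ext ⟨x, y⟩
  · simp only [Equiv.Perm.mul_apply, ff_apply, pv_add u.2, pv_add v.2]; ring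
  · simp only [Equiv.Perm.mul_apply, ff_apply]; ring

lemma ff_one (u v : {u : ZMod p // u ^ q = 1}) : ff u v 0 0 = 1 := by
  ext ⟨x, y⟩ <;> simp [ff_apply]

/-- The family of subgroups. -/
def FF (u v : {u : ZMod p // u ^ q = 1}) : Subgroup (Equiv.Perm (ZMod p × ZMod q)) where
  carrier := {g | ∃ s t, g = ff u v s t}
  mul_mem' := by
    rintro _ _ ⟨s, t, rfl⟩ ⟨s', t', rfl⟩
    exact ⟨_, _, ff_mul ..⟩
  one_mem' := ⟨0, 0, (ff_one u v).symm⟩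
  inv_mem' := by
    rintro _ ⟨s, t, rfl⟩
    refine ⟨-(u.1 ^ (-t).val * v.1 ^ (-t).val * s), -t, ?_⟩
    rw [inv_eq_iff_mul_eq_one, ff_mul, ← ff_one u v]
    have h : v.1 ^ t.val * v.1 ^ (-t).val = 1 := by
      rw [← pv_add v.2]; simp
    congr 1
    · linear_combination (-u.1 ^ (-t).val * s) * h
    · ring

lemma mem_FF {u v : {u : ZMod p // u ^ q = 1}} {g} : g ∈ FF u v ↔ ∃ s t, g = ff u v s t := Iff.rfl

lemma FF_RN (u v : {u : ZMod p // u ^ q = 1}) (h : u.1 = 1 ∨ v.1 = 1) : RN (FF u v) where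
  trans := by
    rintro ⟨x, y⟩ ⟨x', y'⟩
    refine ⟨ff u v ((x' - v.1 ^ (y' - y).val * x) / u.1 ^ y.val) (y' - y), ⟨_, _, rfl⟩, ?_⟩
    rw [ff_apply, div_mul_cancel₀ _ (ch_ne u.2 _)]
    simp
  free := by
    rintro _ ⟨s, t, rfl⟩ ⟨x, y⟩ h
    rw [ff_apply, Prod.mk.injEq] at h
    obtain ⟨h1, h2⟩ := h
    have ht : t = 0 := by simpa using h2
    subst ht
    have hs : s = 0 := by simpa [ch_ne u.2] using h1
    rw [hs, ff_one]
  norm := by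
    rintro ⟨a, b⟩ _ ⟨s, t, rfl⟩
    rcases h with h | h
    · refine ⟨ff u v (s + a - v.1 ^ t.val * a) t, ⟨_, _, rfl⟩, ?_⟩
      rintro ⟨x, y⟩
      simp only [Prod.mk_add_mk, ff_apply, h, one_pow, Prod.mk.injEq]
      exact ⟨by ring, by ring⟩
    · refine ⟨ff u v (s * u.1 ^ (-b).val) t, ⟨_, _, rfl⟩, ?_⟩
      rintro ⟨x, y⟩
      have h' : u.1 ^ b.val * u.1 ^ (-b).val = 1 := by
        rw [← pv_add u.2]; simp
      simp only [Prod.mk_add_mk, ff_apply, h, one_pow, Prod.mk.injEq, pv_add u.2]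
      exact ⟨by linear_combination (s * u.1 ^ y.val) * h', by ring⟩

lemma RN.card {N : Subgroup (Equiv.Perm (ZMod p × ZMod q))} (h : RN N) :
    Nat.card N = p * q := by
  have : Function.Bijective (fun ν : N => ν.1 (0 : ZMod p × ZMod q)) := by
    constructor
    · rintro ⟨a, ha⟩ ⟨b, hb⟩ hab
      simp only at hab
      have := h.free (b⁻¹ * a) (mul_mem (inv_mem hb) ha) 0 (by simp [hab])
      rw [inv_mul_eq_one] at this
      simp [this]
    · intro y
      obtain ⟨ν, hν, hy⟩ := h.trans 0 y
      exact ⟨⟨ν, hν⟩, hy⟩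
  rw [Nat.card_eq_of_bijective _ this]
  simp

lemma RN.eq_of_apply {N : Subgroup (Equiv.Perm (ZMod p × ZMod q))} (h : RN N)
    {a b} (ha : a ∈ N) (hb : b ∈ N) {x} (hx : a x = b x) : a = b := by
  have := h.free (b⁻¹ * a) (mul_mem (inv_mem hb) ha) x (by simp [hx])
  rw [inv_mul_eq_one] at this
  exact this.symm

lemma RN.eq_of_le {N N' : Subgroup (Equiv.Perm (ZMod p × ZMod q))} (h : RN N) (h' : RN N')
    (hle : N ≤ N') : N = N' := by
  apply le_antisymm hle
  intro a ha
  obtain ⟨b, hb, hb'⟩ := h.trans 0 (a 0)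
  rw [← h'.eq_of_apply (hle hb) ha hb']
  exact hb

lemma FF_inj {u v u' v' : {u : ZMod p // u ^ q = 1}}
    (h : FF u v = FF u' v') : u = u' ∧ v = v' := by
  have hone : (1 : ZMod q).val = 1 := ZMod.val_one q
  constructor
  · have h1 : ff u v 1 0 ∈ FF u' v' := h ▸ ⟨_, _, rfl⟩
    obtain ⟨s, t, hst⟩ := h1
    have h2 := congrArg (fun f => f (0, 0)) hst
    have h3 := congrArg (fun f => f (0, 1)) hst
    simp only [ff_apply, Prod.mk.injEq] at h2 h3
    apply Subtype.ext
    have hs : s = 1 := by simpa using h2.1.symm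
    simpa [hone, hs] using h3.1
  · have h1 : ff u v 0 1 ∈ FF u' v' := h ▸ ⟨_, _, rfl⟩
    obtain ⟨s, t, hst⟩ := h1
    have h2 := congrArg (fun f => f (0, 0)) hst
    have h3 := congrArg (fun f => f (1, 0)) hst
    simp only [ff_apply, Prod.mk.injEq] at h2 h3
    apply Subtype.ext
    have hs : s = 0 := by simpa using h2.1.symm
    have ht : t = 1 := by simpa using h2.2.symm
    simpa [hone, hs, ht] using h3.1

lemma FF_comm_iff (u v : {u : ZMod p // u ^ q = 1}) :
    (∀ x y : FF u v, x * y = y * x) ↔ u.1 = v.1 := by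
  have hone : (1 : ZMod q).val = 1 := ZMod.val_one q
  constructor
  · intro h
    have h1 := h ⟨ff u v 1 0, _, _, rfl⟩ ⟨ff u v 0 1, _, _, rfl⟩
    have h2 := congrArg (fun f : FF u v => f.1 (0, 0)) h1
    simpa [ff_apply, hone] using h2
  · rintro h ⟨_, s, t, rfl⟩ ⟨_, s', t', rfl⟩
    apply Subtype.ext
    change ff u v s t * ff u v s' t' = ff u v s' t' * ff u v s t
    rw [ff_mul, ff_mul, h]
    congr 1 <;> ring

lemma FF_iso {G : Type*} [Group G] (hlt : q < p) (hG : Nat.card G = p * q)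
    (hc : ∃ x y : G, x * y ≠ y * x) (v : {u : ZMod p // u ^ q = 1}) (hv1 : v.1 ≠ 1) :
    Nonempty (FF ⟨1, one_pow q⟩ v ≃* G) := by
  obtain ⟨s, t, hs, ht, hst⟩ := pq_gens hlt hG hc v.2 hv1
  have hsp : s ^ p = 1 := hs ▸ pow_orderOf_eq_one s
  have htq : t ^ q = 1 := ht ▸ pow_orderOf_eq_one t
  have hcop : p.Coprime q := (Nat.coprime_primes hp.out hq.out).2 hlt.ne'
  have hfin : Finite G := Nat.finite_of_card_ne_zero (by
    rw [hG]; exact mul_ne_zero hp.out.ne_zero hq.out.ne_zero)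
  have hconj : ∀ (j : ℕ) (a : ZMod p), t ^ j * s ^ a.val = s ^ (v.1 ^ j * a).val * t ^ j := by
    intro j a
    have h1 := conj_pow_nat hst j
    rw [← mul_inv_eq_iff_eq_mul, ← conj_pow, h1, pv_mul hsp]
    congr 1
    rw [← pv_cast hsp]
    simp
  let θ : FF ⟨1, one_pow q⟩ v →* G := MonoidHom.mk'
    (fun g => s ^ (g.1 (0, 0)).1.val * t ^ (g.1 (0, 0)).2.val) (by
      rintro ⟨_, a, b, rfl⟩ ⟨_, c, d, rfl⟩
      simp only [Subgroup.coe_mul, ff_mul, ff_apply, one_pow, mul_zero, zero_add, mul_one, one_mul]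
      rw [pv_add hsp, pv_add htq]
      have h2 := hconj b.val c
      have h3 : s ^ (v.1 ^ b.val * c).val * s ^ a.val = s ^ a.val * s ^ (v.1 ^ b.val * c).val := by
        rw [← pow_add, ← pow_add, add_comm]
      have h4 : t ^ d.val * t ^ b.val = t ^ b.val * t ^ d.val := by
        rw [← pow_add, ← pow_add, add_comm]
      rw [h3, h4, mul_assoc, ← mul_assoc _ (t ^ b.val), ← h2]
      simp only [mul_assoc])
  have hinj : Function.Injective θ := by
    rw [injective_iff_map_eq_one]
    rintro ⟨_, a, b, rfl⟩ h
    change s ^ _ * t ^ _ = 1 at h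
    simp only [ff_apply, one_pow, mul_zero, zero_add, mul_one] at h
    have h1 : s ^ a.val = 1 := by
      rw [← orderOf_eq_one_iff]
      apply Nat.eq_one_of_dvd_coprimes hcop
      · apply orderOf_dvd_of_pow_eq_one
        rw [← pow_mul, mul_comm, pow_mul, hsp, one_pow]
      · apply orderOf_dvd_of_pow_eq_one
        rw [eq_inv_of_mul_eq_one_left h, inv_pow, ← pow_mul, mul_comm, pow_mul, htq, one_pow,
          inv_one]
    rw [h1, one_mul] at h
    have ha : a = 0 := by
      rw [← orderOf_dvd_iff_pow_eq_one, hs] at h1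
      rw [← ZMod.val_eq_zero]
      exact Nat.eq_zero_of_dvd_of_lt h1 (ZMod.val_lt a)
    have hb : b = 0 := by
      rw [← orderOf_dvd_iff_pow_eq_one, ht] at h
      rw [← ZMod.val_eq_zero]
      exact Nat.eq_zero_of_dvd_of_lt h (ZMod.val_lt b)
    subst ha hb
    exact Subtype.ext (ff_one _ _)
  exact ⟨MulEquiv.ofBijective θ (hinj.bijective_of_nat_card_le (by
    rw [hG, (FF_RN _ v (Or.inl rfl)).card]))⟩

end Family

section Classify

variable {p q : ℕ} [hp : Fact p.Prime] [hq : Fact q.Prime]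

lemma addLeft_pow_apply {A : Type*} [AddGroup A] (w : A) (n : ℕ) :
    (Equiv.addLeft w) ^ n = Equiv.addLeft (n • w) := by
  induction n with
  | zero => ext z; simp
  | succ n ih =>
    rw [pow_succ, ih]
    ext z
    simp [add_assoc, succ_nsmul]

lemma perm_inv_self {A : Type*} (f : Equiv.Perm A) (x : A) : f⁻¹ (f x) = x :=
  f.symm_apply_apply x

/-- The permutation `(x, y) ↦ (x + s u ^ y, y)`. -/
def SS (u : {u : ZMod p // u ^ q = 1}) (s : ZMod p) : Equiv.Perm (ZMod p × ZMod q) :=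
  ff u ⟨1, one_pow q⟩ s 0

lemma SS_apply (u : {u : ZMod p // u ^ q = 1}) (s x : ZMod p) (y : ZMod q) :
    SS u s (x, y) = (x + s * u.1 ^ y.val, y) := by
  simp [SS, ff_apply]

lemma RN.conj {N : Subgroup (Equiv.Perm (ZMod p × ZMod q))} (h : RN N) (w) {ν} (hν : ν ∈ N) :
    Equiv.addLeft w * ν * (Equiv.addLeft w)⁻¹ ∈ N := by
  obtain ⟨ν', h1, h2⟩ := h.norm w ν hν
  have : Equiv.addLeft w * ν * (Equiv.addLeft w)⁻¹ = ν' := by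
    rw [mul_inv_eq_iff_eq_mul]
    apply Equiv.ext
    intro z
    simp [h2]
  rwa [this]

lemma RN.step2 {N : Subgroup (Equiv.Perm (ZMod p × ZMod q))} (h : RN N) (hlt : q < p) :
    ∃ u : {u : ZMod p // u ^ q = 1}, (∀ s, SS u s ∈ N) ∧
      ∀ ν ∈ N, ∃ m, ν * SS u 1 * ν⁻¹ = SS u m := by
  obtain ⟨⟨σ, hσN⟩, -, hs, -, h1, -⟩ := pq_struct hlt h.card
  have hσp : σ ^ p = 1 := by
    have := pow_orderOf_eq_one (⟨σ, hσN⟩ : N)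
    rw [hs] at this
    exact congrArg Subtype.val this
  have hσ1 : σ ≠ 1 := by
    rintro rfl
    have : orderOf (1 : N) = p := hs
    rw [orderOf_one] at this
    exact hp.out.one_lt.ne this
  have hP : ∀ g ∈ N, g ^ p = 1 → ∃ k : ℕ, g = σ ^ k := by
    intro g hg hgp
    obtain ⟨k, hk⟩ := h1 ⟨g, hg⟩ (Subtype.ext hgp)
    exact ⟨k, congrArg Subtype.val hk⟩
  have hA : ∀ z, σ ((1, 0) + z) = (1, 0) + σ z := by
    obtain ⟨j, hj⟩ := hP _ (h.conj (1, 0) hσN) (by rw [conj_pow, hσp, mul_one, mul_inv_cancel])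
    have := commute_of_conj hσp (by
      rw [addLeft_pow_apply]
      ext z <;> simp) hj
    rw [mul_inv_eq_iff_eq_mul] at this
    intro z
    have := congrArg (fun f => f z) this
    simpa using this.symm
  have hA2 : ∀ (n : ℕ) z, σ (((n : ZMod p), 0) + z) = ((n : ZMod p), 0) + σ z := by
    intro n
    induction n with
    | zero => intro z; simp [show ((0 : ZMod p), (0 : ZMod q)) = 0 from rfl]
    | succ n ih =>
      intro z
      have e : (((n + 1 : ℕ) : ZMod p), (0 : ZMod q)) = (1, 0) + ((n : ZMod p), 0) := by
        simp [add_comm]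
      rw [e, add_assoc, hA, ih, add_assoc]
  have hA3 : ∀ x y, σ (x, y) = (x, 0) + σ (0, y) := by
    intro x y
    have := hA2 x.val (0, y)
    simpa using this
  have hpi : ∀ y, (σ (0, y)).2 = y := by
    have h3 : ∀ (n : ℕ) z, ((σ ^ n) z).2 = (fun y => (σ (0, y)).2)^[n] z.2 := by
      intro n
      induction n with
      | zero => intro z; simp
      | succ n ih =>
        rintro ⟨x, y⟩
        rw [pow_succ, Equiv.Perm.mul_apply, ih, Function.iterate_succ_apply, hA3 x y]
        simp
    intro y
    have h4 : Function.IsPeriodicPt (fun y => (σ (0, y)).2) p y := by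
      have := h3 p (0, y)
      rw [hσp] at this
      exact this.symm
    have h5 := h4.minimalPeriod_dvd
    rcases (Nat.dvd_prime hp.out).1 h5 with h6 | h6
    · have := Function.isPeriodicPt_minimalPeriod (fun y => (σ (0, y)).2) y
      rw [h6] at this
      exact this
    · have := Function.minimalPeriod_le_card (f := fun y => (σ (0, y)).2) (x := y)
      rw [h6, ZMod.card] at this
      omega
  obtain ⟨c, hc⟩ : ∃ c : ZMod q → ZMod p, ∀ x y, σ (x, y) = (x + c y, y) := by
    refine ⟨fun y => (σ (0, y)).1, fun x y => ?_⟩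
    rw [hA3]
    ext <;> simp [hpi]
  have hcn : ∀ (n : ℕ) x y, (σ ^ n) (x, y) = (x + n * c y, y) := by
    intro n
    induction n with
    | zero => intro x y; simp
    | succ n ih =>
      intro x y
      rw [pow_succ, Equiv.Perm.mul_apply, hc, ih]
      push_cast
      congr 1; ring
  have hc0 : ∀ y, c y ≠ 0 := by
    intro y hy
    exact hσ1 (h.free σ hσN (0, y) (by rw [hc, hy]; simp))
  obtain ⟨k, hk⟩ := hP _ (h.conj (0, 1) hσN) (by rw [conj_pow, hσp, mul_one, mul_inv_cancel])
  have hk2 : ∀ y, c y = k * c (y + 1) := by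
    intro y
    rw [mul_inv_eq_iff_eq_mul] at hk
    have := congrArg (fun f => f (0, y)) hk
    simp only [Equiv.Perm.mul_apply, hc, Equiv.coe_addLeft, Prod.mk_add_mk, hcn] at this
    have := congrArg Prod.fst this
    simpa [add_comm] using this
  have hk0 : (k : ZMod p) ≠ 0 := by
    intro hk0
    have := hk2 0
    rw [hk0, zero_mul] at this
    exact hc0 0 this
  have hu1 : ∀ n : ℕ, c n = c 0 * ((k : ZMod p)⁻¹) ^ n := by
    intro n
    induction n with
    | zero => simp
    | succ n ih =>
      have := hk2 n
      rw [ih] at this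
      push_cast
      rw [pow_succ, ← mul_assoc, this]
      field_simp
  have huq : ((k : ZMod p)⁻¹) ^ q = 1 := by
    have := hu1 q
    rw [ZMod.natCast_self] at this
    exact (mul_eq_left₀ (hc0 0)).1 this.symm
  have hpow : ∀ n : ℕ, σ ^ n = SS ⟨(k : ZMod p)⁻¹, huq⟩ (n * c 0) := by
    intro n
    apply Equiv.ext
    rintro ⟨x, y⟩
    rw [hcn, SS_apply, mul_assoc, ← hu1 y.val]
    simp
  have hS : ∀ s, SS ⟨(k : ZMod p)⁻¹, huq⟩ s = σ ^ (s / c 0).val := by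
    intro s
    rw [hpow]
    congr 1
    simp [div_mul_cancel₀ _ (hc0 0)]
  refine ⟨⟨(k : ZMod p)⁻¹, huq⟩, ?_, ?_⟩
  · intro s
    rw [hS]
    exact pow_mem hσN _
  · intro ν hν
    obtain ⟨m, hm⟩ := hP (ν * SS ⟨(k : ZMod p)⁻¹, huq⟩ 1 * ν⁻¹)
      (mul_mem (mul_mem hν (by rw [hS]; exact pow_mem hσN _)) (inv_mem hν)) (by
        rw [conj_pow, hS, ← pow_mul, mul_comm, pow_mul, hσp]; simp)
    exact ⟨_, hm.trans (hpow m)⟩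

lemma RN.step3 {N : Subgroup (Equiv.Perm (ZMod p × ZMod q))}
    {u : {u : ZMod p // u ^ q = 1}} 
    (h2 : ∀ ν ∈ N, ∃ m, ν * SS u 1 * ν⁻¹ = SS u m) : 
    ∀ ν ∈ N, ∃ m, ∀ x y, ν (x, y) = ν (0, y) + (m * x * u.1 ^ (ν (0, y)).2.val / u.1 ^ y.val, 0) := by
  intro ν hν
  obtain ⟨m, hm⟩ := h2 ν hν
  refine ⟨m, ?_⟩
  rw [mul_inv_eq_iff_eq_mul] at hm
  have h3 : ∀ x y, ν (x + u.1 ^ y.val, y) = ν (x, y) + (m * u.1 ^ (ν (x, y)).2.val, 0) := by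
    intro x y
    have := congrArg (fun f => f (x, y)) hm
    simp only [Equiv.Perm.mul_apply, SS_apply, one_mul] at this
    rw [this]
    obtain ⟨a, b⟩ := ν (x, y)
    simp [SS_apply]
  have h4 : ∀ (n : ℕ) y, ν (n * u.1 ^ y.val, y) =
      ν (0, y) + (n * (m * u.1 ^ (ν (0, y)).2.val), 0) := by
    intro n y
    induction n with
    | zero => simp [show ((0 : ZMod p), (0 : ZMod q)) = 0 from rfl]
    | succ n ih =>
      push_cast
      rw [add_mul, one_mul, h3, ih]
      simp only [Prod.snd_add, add_zero, add_assoc, Prod.mk_add_mk]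
      congr 2; ring
  intro x y
  have := h4 (x / u.1 ^ y.val).val y
  simp only [ZMod.natCast_val, ZMod.cast_id', id, div_mul_cancel₀ _ (ch_ne u.2 y.val)] at this
  rw [this]
  congr 2; ring

lemma RN.step4 {N : Subgroup (Equiv.Perm (ZMod p × ZMod q))} (h : RN N) (hlt : q < p)
    (hb : ∀ ν ∈ N, ∀ x y, (ν (x, y)).2 = (ν (0, y)).2) :
    ∃ ν ∈ N, ∀ x y, (ν (x, y)).2 = y + 1 := by
  let Φ0 : N →* Function.End (ZMod q) :=
    { toFun := fun ν y => (ν.1 (0, y)).2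
      map_one' := by funext y; rfl
      map_mul' := by
        rintro ⟨a, ha⟩ ⟨b, hb'⟩
        funext y
        change (a (b (0, y))).2 = (a (0, (b (0, y)).2)).2
        rw [← hb a ha (b (0, y)).1] }
  let Φ : N →* Equiv.Perm (ZMod q) := Φ0.toHomPerm
  have hΦ : ∀ (ν : N) y, Φ ν y = (ν.1 (0, y)).2 := fun ν y => rfl
  obtain ⟨s, t, hs, ht, h1, h2⟩ := pq_struct hlt h.card
  have hΦs : Φ s = 1 := by
    rw [← orderOf_eq_one_iff]
    have hd1 : orderOf (Φ s) ∣ p := (orderOf_map_dvd Φ s).trans (dvd_of_eq hs)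
    rcases (Nat.dvd_prime hp.out).1 hd1 with h3 | h3
    · exact h3
    · exfalso
      have h4 : orderOf (Φ s) ∣ q.factorial := by
        have := orderOf_dvd_natCard (Φ s)
        rwa [Nat.card_perm, Nat.card_zmod] at this
      rw [h3, hp.out.dvd_factorial] at h4
      omega
  have hΦt : Φ t ^ q = 1 := by
    have : t ^ q = 1 := orderOf_dvd_iff_pow_eq_one.1 (dvd_of_eq ht)
    rw [← map_pow, this, map_one]
  have hpow : ∀ g : N, ∃ j : ℕ, Φ g = Φ t ^ j := by
    intro g
    obtain ⟨i, j, rfl⟩ := h2 g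
    exact ⟨j, by rw [map_mul, map_pow, map_pow, hΦs, one_pow, one_mul]⟩
  obtain ⟨j, hj⟩ := hpow ⟨_, h.conj (0, 1) t.2⟩
  have hconj : Equiv.addLeft (1 : ZMod q) * Φ t * (Equiv.addLeft (1 : ZMod q))⁻¹ = Φ t ^ j := by
    rw [← hj, mul_inv_eq_iff_eq_mul]
    apply Equiv.ext
    intro y
    rw [Equiv.Perm.mul_apply, Equiv.Perm.mul_apply, hΦ, hΦ, Equiv.coe_addLeft]
    simp only
    have e : ((0 : ZMod p), 1 + y) = Equiv.addLeft ((0 : ZMod p), (1 : ZMod q)) (0, y) := by simp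
    rw [e, Equiv.Perm.mul_apply _ (Equiv.addLeft _)⁻¹, perm_inv_self]
    simp
  have hcomm := commute_of_conj hΦt (by
    rw [addLeft_pow_apply]
    ext z; simp) hconj
  rw [mul_inv_eq_iff_eq_mul] at hcomm
  obtain ⟨ν, hν, hν1⟩ := h.trans (0, 0) (0, 1)
  obtain ⟨i, hi⟩ := hpow ⟨ν, hν⟩
  have hcomm2 : Commute (Equiv.addLeft (1 : ZMod q)) (Φ ⟨ν, hν⟩) := by
    rw [hi]; exact Commute.pow_right hcomm i
  have hcomm3 : ∀ y, Φ ⟨ν, hν⟩ (1 + y) = 1 + Φ ⟨ν, hν⟩ y := by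
    intro y
    have := congrArg (fun f => f y) hcomm2.eq
    simpa using this.symm
  have h5 : ∀ n : ℕ, Φ ⟨ν, hν⟩ n = n + 1 := by
    intro n
    induction n with
    | zero => simp [hΦ, hν1]
    | succ n ih =>
      push_cast
      rw [add_comm (n : ZMod q) 1, hcomm3, ih]; ring
  refine ⟨ν, hν, fun x y => ?_⟩
  have := h5 y.val
  rw [hΦ] at this
  rw [hb ν hν]
  simpa using this

lemma RN.classify {N : Subgroup (Equiv.Perm (ZMod p × ZMod q))} (h : RN N) (hlt : q < p) :
    ∃ u v : {u : ZMod p // u ^ q = 1}, (u.1 = 1 ∨ v.1 = 1) ∧ N = FF u v := by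
  have hone : (1 : ZMod q).val = 1 := ZMod.val_one q
  have hqp : (q : ZMod p) ≠ 0 := by
    rw [Ne, ZMod.natCast_eq_zero_iff]
    exact Nat.not_dvd_of_pos_of_lt hq.out.pos hlt
  obtain ⟨u, hS, h2⟩ := h.step2 hlt
  have h3 := RN.step3 h2
  obtain ⟨τ, hτ, hτ2⟩ := h.step4 hlt (by
    intro ν hν x y
    obtain ⟨m, hm⟩ := h3 ν hν
    rw [hm]; simp)
  have hch : ∀ y : ZMod q, u.1 ^ (y + 1).val = u.1 * u.1 ^ y.val := by
    intro y; rw [pv_add u.2, hone, pow_one, mul_comm]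
  obtain ⟨v, g, hvg⟩ : ∃ (v : ZMod p) (g : ZMod q → ZMod p),
      ∀ x y, τ (x, y) = (v * x + g y, y + 1) := by
    obtain ⟨m, hm⟩ := h3 τ hτ
    refine ⟨m * u.1, fun y => (τ (0, y)).1, fun x y => ?_⟩
    ext
    · rw [hm, hτ2, hch]
      have := ch_ne u.2 y.val
      simp only [Prod.fst_add]
      field_simp
      ring
    · exact hτ2 x y
  -- elements fixing the block structure
  have hfix : ∀ ν ∈ N, (ν (0, 0)).2 = 0 → ∃ e, ν = SS u e := by
    intro ν hν h0
    refine ⟨(ν (0, 0)).1, h.eq_of_apply hν (hS _) (x := (0, 0)) ?_⟩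
    rw [SS_apply]
    ext <;> simp [h0]
  have hfix2 : ∀ w, ∃ e, Equiv.addLeft w * τ = SS u e * (τ * Equiv.addLeft w) := by
    intro w
    obtain ⟨e, he⟩ := hfix (Equiv.addLeft w * τ * (Equiv.addLeft w)⁻¹ * τ⁻¹)
      (mul_mem (h.conj w hτ) (inv_mem hτ)) (by
        obtain ⟨⟨x, y⟩, hxy⟩ := (τ * Equiv.addLeft w).surjective (0, 0)
        have e1 : Equiv.addLeft w * τ * (Equiv.addLeft w)⁻¹ * τ⁻¹ =
          Equiv.addLeft w * τ * (τ * Equiv.addLeft w)⁻¹ := by group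
        rw [e1, ← hxy, Equiv.Perm.mul_apply, perm_inv_self]
        obtain ⟨a, b⟩ := w
        simp only [Equiv.Perm.mul_apply, Equiv.coe_addLeft, Prod.mk_add_mk, hvg,
          Prod.mk.injEq] at hxy ⊢
        rw [← hxy.2]; ring)
    refine ⟨e, ?_⟩
    rw [← he]; group
  obtain ⟨e, he⟩ := hfix2 (1, 0)
  have he' : ∀ y : ZMod q, 1 - v = e * u.1 ^ (y + 1).val := by
    intro y
    have := congrArg (fun f => (f (0, y)).1) he
    simp only [Equiv.Perm.mul_apply, Equiv.coe_addLeft, Prod.mk_add_mk, hvg, SS_apply,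
      zero_add, add_zero] at this
    linear_combination this
  have huv : u.1 = 1 ∨ v = 1 := by
    by_cases hu : u.1 = 1
    · exact Or.inl hu
    · right
      have e1 := he' 0
      have e2 := he' (-1)
      simp only [zero_add, hone, pow_one, neg_add_cancel, ZMod.val_zero, pow_zero] at e1 e2
      have e3 : e * (u.1 - 1) = 0 := by linear_combination e2 - e1
      rcases mul_eq_zero.1 e3 with e4 | e4
      · rw [e4] at e2
        linear_combination -e2
      · exact absurd (sub_eq_zero.1 e4) hu
  obtain ⟨f, hf⟩ := hfix2 (0, 1)
  have hf' : ∀ y : ZMod q, g y = g (y + 1) + f * u.1 ^ 2 * u.1 ^ y.val := by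
    intro y
    have := congrArg (fun f => (f (0, y)).1) hf
    simp only [Equiv.Perm.mul_apply, Equiv.coe_addLeft, Prod.mk_add_mk, hvg, SS_apply,
      zero_add, add_zero, mul_zero, add_comm 1 y, hch] at this
    linear_combination this
  -- the normalised element
  obtain ⟨τ', hτ', hτv⟩ : ∃ τ' ∈ N, ∀ x y, τ' (x, y) = (v * x, y + 1) := by
    by_cases hu : u.1 = 1
    · have h5 : ∀ n : ℕ, g n = g 0 - n * f := by
        intro n
        induction n with
        | zero => simp
        | succ n ih =>
          have := hf' n
          rw [hu] at this
          push_cast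
          simp only [one_pow, mul_one] at this
          linear_combination ih - this
      have hf0 : f = 0 := by
        have := h5 q
        rw [ZMod.natCast_self] at this
        have h6 : (q : ZMod p) * f = 0 := by linear_combination this
        exact (mul_eq_zero.1 h6).resolve_left hqp
      refine ⟨SS u (-g 0) * τ, mul_mem (hS _) hτ, fun x y => ?_⟩
      have := h5 y.val
      rw [hf0] at this
      rw [Equiv.Perm.mul_apply, hvg, SS_apply, hu]
      simp only [ZMod.natCast_val, ZMod.cast_id', id, mul_zero, sub_zero] at this
      simp [this]
    · have hv : v = 1 := huv.resolve_left hu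
      have hu' : u.1 - 1 ≠ 0 := sub_ne_zero.2 hu
      have hu0 : u.1 ≠ 0 := by simpa using ch_ne u.2 1
      obtain ⟨d, hd⟩ : ∃ d, d * u.1 * (u.1 - 1) = f * u.1 ^ 2 :=
        ⟨f * u.1 / (u.1 - 1), by field_simp⟩
      have h5 : ∀ n : ℕ, g n + d * u.1 * u.1 ^ (n : ZMod q).val = g 0 + d * u.1 := by
        intro n
        induction n with
        | zero => simp
        | succ n ih =>
          have := hf' n
          push_cast
          rw [hch]
          linear_combination ih - this + (u.1 ^ (n : ZMod q).val) * hd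
      set C := g 0 + d * u.1 with hC
      set τ' := SS u d * τ with hτ'
      have hτ'N : τ' ∈ N := mul_mem (hS _) hτ
      have h6 : ∀ x y, τ' (x, y) = (x + C, y + 1) := by
        intro x y
        rw [hτ', Equiv.Perm.mul_apply, hvg, SS_apply, hv, hch]
        have := h5 y.val
        simp only [ZMod.natCast_val, ZMod.cast_id', id] at this
        rw [← this]
        congr 1; ring
      have h7 : ∀ (n : ℕ) x y, (τ' ^ n) (x, y) = (x + n * C, y + n) := by
        intro n
        induction n with
        | zero => intro x y; simp
        | succ n ih =>
          intro x y
          rw [pow_succ, Equiv.Perm.mul_apply, h6, ih]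
          push_cast
          ext
          · simp only; ring
          · simp only; ring
      obtain ⟨k, hk⟩ := hfix (τ' ^ q) (pow_mem hτ'N q) (by rw [h7]; simp)
      have h8 : ∀ y : ZMod q, (q : ZMod p) * C = k * u.1 ^ y.val := by
        intro y
        have := h7 q 0 y
        rw [hk, SS_apply] at this
        simpa using (congrArg Prod.fst this).symm
      have e1 := h8 0
      have e2 := h8 1
      simp only [hone, pow_one, ZMod.val_zero, pow_zero] at e1 e2
      have e3 : k * (u.1 - 1) = 0 := by linear_combination e1 - e2
      have e4 : k = 0 := (mul_eq_zero.1 e3).resolve_right hu'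
      rw [e4, zero_mul] at e2
      have hC0 : C = 0 := (mul_eq_zero.1 e2).resolve_left hqp
      exact ⟨τ', hτ'N, fun x y => by rw [h6, hC0, hv]; simp⟩
  have h7 : ∀ (n : ℕ) x y, (τ' ^ n) (x, y) = (v ^ n * x, y + n) := by
    intro n
    induction n with
    | zero => intro x y; simp
    | succ n ih =>
      intro x y
      rw [pow_succ, Equiv.Perm.mul_apply, hτv, ih]
      push_cast
      ext
      · simp only; ring
      · simp only; ring
  have hvq : v ^ q = 1 := by
    have h8 : τ' ^ q = 1 := h.free _ (pow_mem hτ' q) (0, 0) (by rw [h7]; simp)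
    have h9 := h7 q 1 0
    rw [h8] at h9
    simpa using (congrArg Prod.fst h9).symm
  refine ⟨u, ⟨v, hvq⟩, huv, ?_⟩
  symm
  apply (FF_RN u ⟨v, hvq⟩ huv).eq_of_le h
  rintro _ ⟨s, t, rfl⟩
  have : ff u ⟨v, hvq⟩ s t = SS u (s / u.1 ^ t.val) * τ' ^ t.val := by
    apply Equiv.ext
    rintro ⟨x, y⟩
    rw [Equiv.Perm.mul_apply, h7, SS_apply, ff_apply]
    have := ch_ne u.2 t.val
    ext
    · simp only [ZMod.natCast_val, ZMod.cast_id', id, pv_add u.2]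
      field_simp
    · simp
  rw [this]
  exact mul_mem (hS _) (pow_mem hτ' _)

end Classify

section Count

variable {p q : ℕ} [hp : Fact p.Prime] [hq : Fact q.Prime]

lemma card_Rt (hdvd : q ∣ p - 1) : Nat.card {u : ZMod p // u ^ q = 1} = q := by
  obtain ⟨z, hz⟩ := exists_prime_orderOf_dvd_card' (G := (ZMod p)ˣ) q (by
    rw [Nat.card_eq_fintype_card, ZMod.card_units]; exact hdvd)
  have hprim : IsPrimitiveRoot (z : ZMod p) q := by
    rw [IsPrimitiveRoot.coe_units_iff, ← hz]; exact IsPrimitiveRoot.orderOf z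
  have h := hprim.card_nthRootsFinset
  refine Eq.trans ?_ h
  rw [← Nat.card_eq_finsetCard]
  apply Nat.card_congr
  apply Equiv.subtypeEquivRight
  intro x
  rw [Polynomial.mem_nthRootsFinset hq.out.pos]

lemma ncard_pairs (hdvd : q ∣ p - 1) :
    {z : {u : ZMod p // u ^ q = 1} × {u : ZMod p // u ^ q = 1} |
      (z.1.1 = 1 ∨ z.2.1 = 1) ∧ z.1.1 ≠ z.2.1}.ncard = 2 * (q - 1) := by
  set o : {u : ZMod p // u ^ q = 1} := ⟨1, one_pow q⟩ with ho
  have hset : {z : {u : ZMod p // u ^ q = 1} × {u : ZMod p // u ^ q = 1} |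
      (z.1.1 = 1 ∨ z.2.1 = 1) ∧ z.1.1 ≠ z.2.1} =
      (fun u => (u, o)) '' {o}ᶜ ∪ (fun u => (o, u)) '' {o}ᶜ := by
    ext ⟨a, b⟩
    have e : ∀ a : {u : ZMod p // u ^ q = 1}, a.1 = 1 ↔ a = o := fun a => by
      rw [Subtype.ext_iff]
    simp only [e, ← Subtype.ext_iff, ne_eq, Set.mem_setOf_eq, Set.mem_union, Set.mem_image,
      Set.mem_compl_iff, Set.mem_singleton_iff, Prod.mk.injEq]
    constructor
    · rintro ⟨h | h, h'⟩
      · exact Or.inr ⟨b, fun hb => h' (h.trans hb.symm), h.symm, rfl⟩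
      · exact Or.inl ⟨a, fun hb => h' (hb.trans h.symm), rfl, h.symm⟩
    · rintro (⟨c, hc, rfl, rfl⟩ | ⟨c, hc, rfl, rfl⟩)
      · exact ⟨Or.inr rfl, hc⟩
      · exact ⟨Or.inl rfl, fun h => hc h.symm⟩
  have hcard : ({o}ᶜ : Set {u : ZMod p // u ^ q = 1}).ncard = q - 1 := by
    rw [Set.ncard_compl, Set.ncard_singleton, card_Rt hdvd]
  rw [hset, Set.ncard_union_eq, Set.InjOn.ncard_image, Set.InjOn.ncard_image, hcard]
  · ring
  · intro a _ b _ h; exact (Prod.mk.inj h).2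
  · intro a _ b _ h; exact (Prod.mk.inj h).1
  · rw [Set.disjoint_left]
    rintro _ ⟨a, ha, rfl⟩ ⟨b, hb, h⟩
    exact ha (Prod.mk.inj h).1.symm

lemma noncomm_iso {G M : Type*} [Group G] [Group M] (hlt : q < p) (hdvd : q ∣ p - 1)
    (hG : Nat.card G = p * q) (hM : Nat.card M = p * q)
    (hcG : ∃ x y : G, x * y ≠ y * x) (hcM : ∃ x y : M, x * y ≠ y * x) : Nonempty (G ≃* M) := by
  have h1 : 1 < Nat.card {u : ZMod p // u ^ q = 1} := by
    rw [card_Rt hdvd]; exact hq.out.one_lt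
  have : Nontrivial {u : ZMod p // u ^ q = 1} := (Finite.one_lt_card_iff_nontrivial).1 h1
  obtain ⟨v, hv⟩ := exists_ne (⟨1, one_pow q⟩ : {u : ZMod p // u ^ q = 1})
  have hv' : v.1 ≠ 1 := fun h => hv (Subtype.ext h)
  obtain ⟨f⟩ := FF_iso hlt hG hcG v hv'
  obtain ⟨g⟩ := FF_iso hlt hM hcM v hv'
  exact ⟨f.symm.trans g⟩

lemma count_M {M : Type*} [Group M] (hlt : q < p) (hdvd : q ∣ p - 1)
    (hM : Nat.card M = p * q) (hcM : ∃ x y : M, x * y ≠ y * x) :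
    Nat.card {N : Subgroup (Equiv.Perm (ZMod p × ZMod q)) // Nonempty (N ≃* M) ∧ RN N} =
      2 * (q - 1) := by
  rw [← ncard_pairs hdvd]
  have hset : {N : Subgroup (Equiv.Perm (ZMod p × ZMod q)) | Nonempty (N ≃* M) ∧ RN N} =
      (fun z => FF z.1 z.2) '' {z : {u : ZMod p // u ^ q = 1} × {u : ZMod p // u ^ q = 1} |
      (z.1.1 = 1 ∨ z.2.1 = 1) ∧ z.1.1 ≠ z.2.1} := by
    ext N
    constructor
    · rintro ⟨⟨f⟩, h⟩
      obtain ⟨u, v, huv, rfl⟩ := h.classify hlt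
      refine ⟨(u, v), ⟨huv, ?_⟩, rfl⟩
      intro heq
      have := (FF_comm_iff u v).2 heq
      obtain ⟨x, y, hxy⟩ := hcM
      apply hxy
      apply f.symm.injective
      rw [map_mul, map_mul, this]
    · rintro ⟨⟨u, v⟩, ⟨huv, hne⟩, rfl⟩
      have h := FF_RN u v huv
      refine ⟨noncomm_iso hlt hdvd h.card hM ?_ hcM, h⟩
      by_contra! hcon
      exact hne ((FF_comm_iff u v).1 hcon)
  rw [← Set.InjOn.ncard_image (f := fun z => FF z.1 z.2), ← hset]
  · rfl
  · rintro ⟨a, b⟩ _ ⟨c, d⟩ _ h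
    obtain ⟨h1, h2⟩ := FF_inj h
    exact Prod.ext h1 h2

lemma count_C {G : Type*} [Group G] [IsCyclic G] (hlt : q < p) (hG : Nat.card G = p * q) :
    Nat.card {N : Subgroup (Equiv.Perm (ZMod p × ZMod q)) // Nonempty (N ≃* G) ∧ RN N} = 1 := by
  have hset : {N : Subgroup (Equiv.Perm (ZMod p × ZMod q)) | Nonempty (N ≃* G) ∧ RN N} =
      {FF ⟨1, one_pow q⟩ ⟨1, one_pow q⟩} := by
    ext N
    constructor
    · rintro ⟨⟨f⟩, h⟩
      obtain ⟨u, v, huv, rfl⟩ := h.classify hlt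
      have h1 := (FF_comm_iff u v).1 (by
        intro x y
        apply f.injective
        rw [map_mul, map_mul]
        letI := IsCyclic.commGroup (α := G)
        exact mul_comm (f x) (f y))
      have hu : u.1 = 1 := by
        rcases huv with h | h
        · exact h
        · rw [h1, h]
      have e1 : u = ⟨1, one_pow q⟩ := Subtype.ext hu
      have e2 : v = ⟨1, one_pow q⟩ := Subtype.ext (h1 ▸ hu)
      rw [e1, e2]; rfl
    · rintro rfl
      have h := FF_RN (p := p) (q := q) ⟨1, one_pow q⟩ ⟨1, one_pow q⟩ (Or.inl rfl)
      have : IsCyclic (FF (p := p) (q := q) ⟨1, one_pow q⟩ ⟨1, one_pow q⟩) :=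
        pq_cyclic hlt h.card ((FF_comm_iff _ _).2 rfl)
      exact ⟨⟨mulEquivOfCyclicCardEq (h.card.trans hG.symm)⟩, h⟩
  change Set.ncard {N : Subgroup (Equiv.Perm (ZMod p × ZMod q)) | Nonempty (N ≃* G) ∧ RN N} = 1
  rw [hset, Set.ncard_singleton]

lemma transport {Γ : Type} [Group Γ] {M : Type} [Group M] (e : Γ ≃ ZMod p × ZMod q)
    (he : ∀ a b, e (a * b) = e a + e b) :
    Nat.card {N : Subgroup (Equiv.Perm Γ) //
        Nonempty (N ≃* M) ∧ IsRegularSubgroup Γ N ∧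
          IsNormalizedByLeftTranslations Γ N} =
    Nat.card {N : Subgroup (Equiv.Perm (ZMod p × ZMod q)) // Nonempty (N ≃* M) ∧ RN N} := by
  apply Nat.card_congr
  apply Equiv.subtypeEquiv e.permCongrHom.mapSubgroup.toEquiv
  intro N
  change _ ↔ Nonempty (N.map e.permCongrHom.toMonoidHom ≃* M) ∧
    RN (N.map e.permCongrHom.toMonoidHom)
  have hap : ∀ (ν : Equiv.Perm Γ) x, e.permCongrHom.toMonoidHom ν (e x) = e (ν x) := by
    intro ν x
    change e (ν (e.symm (e x))) = _
    simp
  have hmem : ∀ ν ∈ N, e.permCongrHom.toMonoidHom ν ∈ N.map e.permCongrHom.toMonoidHom :=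
    fun ν hν => Subgroup.mem_map_of_mem _ hν
  have hinj : Function.Injective e.permCongrHom.toMonoidHom := e.permCongrHom.injective
  have f : N ≃* N.map e.permCongrHom.toMonoidHom := e.permCongrHom.subgroupMap N
  refine and_congr ⟨fun ⟨g⟩ => ⟨f.symm.trans g⟩, fun ⟨g⟩ => ⟨f.trans g⟩⟩ ?_
  constructor
  · rintro ⟨⟨h1, h2⟩, h3⟩
    constructor
    · intro x y
      obtain ⟨ν, hν, h⟩ := h1 (e.symm x) (e.symm y)
      refine ⟨_, hmem ν hν, ?_⟩
      rw [← e.apply_symm_apply x, hap, h, e.apply_symm_apply]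
    · rintro _ ⟨ν, hν, rfl⟩ x hx
      have := h2 ν hν (e.symm x) (by
        apply e.injective
        rw [← hap, e.apply_symm_apply]; exact hx)
      rw [this, map_one]
    · rintro w _ ⟨ν, hν, rfl⟩
      refine ⟨_, hmem _ (h3 (e.symm w) ν hν), fun z => ?_⟩
      have e1 : w + z = e (Equiv.mulLeft (e.symm w) (e.symm z)) := by
        simp [he]
      rw [e1, hap, Equiv.Perm.mul_apply, perm_inv_self, Equiv.Perm.mul_apply, Equiv.coe_mulLeft,
        he, ← hap]
      simp
  · intro h
    refine ⟨⟨?_, ?_⟩, ?_⟩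
    · intro x y
      obtain ⟨_, ⟨ν, hν, rfl⟩, h'⟩ := h.trans (e x) (e y)
      refine ⟨ν, hν, e.injective ?_⟩
      rw [← hap]; exact h'
    · intro ν hν x hx
      apply hinj
      rw [map_one]
      apply h.free _ (hmem ν hν) (e x)
      rw [hap, hx]
    · intro γ ν hν
      obtain ⟨_, ⟨ν', hν', rfl⟩, h'⟩ := h.norm (e γ) _ (hmem ν hν)
      have : Equiv.mulLeft γ * ν * (Equiv.mulLeft γ)⁻¹ = ν' := by
        rw [mul_inv_eq_iff_eq_mul]
        apply Equiv.ext
        intro x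
        apply e.injective
        have h4 := h' (e x)
        rw [← he] at h4
        have h5 : e (ν' (γ * x)) = e γ + e (ν x) := by
          rw [← hap, ← hap]; exact h4
        simp only [Equiv.Perm.mul_apply, Equiv.coe_mulLeft, he]
        exact h5.symm
      rw [this]
      exact hν'

end Count

/-- **Two primes.** Let `p > q` be primes with `q ∣ p - 1`, `n = pq`, `Γ` cyclic of
order `n`, and `M` the (unique up to isomorphism) nonabelian group of order `pq`.
Then a cyclic extension of degree `pq` admits exactly `2(q-1)` Hopf–Galois structures of
type `M` and exactly one of cyclic type; i.e. there are exactly `2(q-1)` regular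
subgroups of `Perm Γ` isomorphic to `M` and normalised by left translations, and
exactly one isomorphic to `Γ` and normalised by left translations. -/
theorem two_primes_hgs_count (p q : ℕ) (hp : p.Prime) (hq : q.Prime) (hlt : q < p)
    (hdvd : q ∣ p - 1)
    (Γ : Type) [Group Γ] [IsCyclic Γ] (hΓ : Nat.card Γ = p * q)
    (M : Type) [Group M] (hM : Nat.card M = p * q)
    (hnab : ∃ x y : M, x * y ≠ y * x) :
    Nat.card {N : Subgroup (Equiv.Perm Γ) //
        Nonempty (N ≃* M) ∧ IsRegularSubgroup Γ N ∧
          IsNormalizedByLeftTranslations Γ N} = 2 * (q - 1) ∧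
    Nat.card {N : Subgroup (Equiv.Perm Γ) //
        Nonempty (N ≃* Γ) ∧ IsRegularSubgroup Γ N ∧
          IsNormalizedByLeftTranslations Γ N} = 1 := by
  haveI : Fact p.Prime := ⟨hp⟩
  haveI : Fact q.Prime := ⟨hq⟩
  have hcop : p.Coprime q := (Nat.coprime_primes hp hq).2 hlt.ne'
  obtain ⟨e, he⟩ : ∃ e : Γ ≃ ZMod p × ZMod q, ∀ a b, e (a * b) = e a + e b := by
    let f : Multiplicative (ZMod (Nat.card Γ)) ≃* Γ := zmodCyclicMulEquiv inferInstance
    rw [hΓ] at f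
    let g := ZMod.chineseRemainder hcop
    exact ⟨(f.symm.toEquiv.trans Multiplicative.toAdd).trans g.toEquiv, fun a b => by simp⟩
  rw [transport e he, transport e he]
  exact ⟨count_M hlt hdvd hM hnab, count_C hlt hΓ⟩
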